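/- arXiv:0802.4345 — 2 statements merged into one kernel-verified Lean document; each statement's English description precedes it below -/
import Mathlib

section
/- (Beckman–Quarles) Let n ≥ 2 and δ > 0, and let f : ℝⁿ → ℝⁿ be any map (not assumed continuous, injective, or surjective) such that for all x, y ∈ ℝⁿ, ‖x − y‖ = δ implies ‖f(x) − f(y)‖ = δ, where ‖·‖ denotes the Euclidean norm. Then f is a Euclidean motion: there exist an orthogonal linear map A ∈ O(n) and a vector a ∈ ℝⁿ with f(x) = A·x + a for all x; in particular ‖f(x) − f(y)‖ = ‖x − y‖ for all x, y. -/
/-- `f` preserves the distance `r`. -/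
def BQPres {n : ℕ} (f : EuclideanSpace ℝ (Fin n) → EuclideanSpace ℝ (Fin n)) (r : ℝ) : Prop :=
  ∀ x y, ‖x - y‖ = r → ‖f x - f y‖ = r

/-- Two points equidistant from a regular simplex with `n` vertices. -/
lemma bq_uniq (n : ℕ) (hn : 2 ≤ n) (a b c : ℝ) (ha : 0 < a) (hc : 0 < c)
    (habc : c ^ 2 = 4 * b ^ 2 - (2 - 2 / (n : ℝ)) * a ^ 2)
    (P : Fin n → EuclideanSpace ℝ (Fin n)) (p q : EuclideanSpace ℝ (Fin n))
    (hP : ∀ i j, i ≠ j → ‖P i - P j‖ = a)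
    (hp : ∀ i, ‖P i - p‖ = b) (hq : ∀ i, ‖P i - q‖ = b) : p = q ∨ ‖p - q‖ = c := by
  have hn0 : (0 : ℝ) < n := by positivity
  by_cases hpq : p = q
  · exact Or.inl hpq
  right
  obtain ⟨v, hv⟩ : ∃ v : Fin n → EuclideanSpace ℝ (Fin n), ∀ i, v i = P i - p := ⟨_, fun _ => rfl⟩
  obtain ⟨d, hd⟩ : ∃ d, d = q - p := ⟨_, rfl⟩
  have hd0 : 0 < ‖d‖ ^ 2 := by
    have : d ≠ 0 := by rw [hd]; exact sub_ne_zero.mpr (Ne.symm hpq)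
    positivity
  have hvv : ∀ i, ‖v i‖ ^ 2 = b ^ 2 := fun i => by rw [hv, hp]
  have hin : ∀ i j, inner ℝ (v i) (v j) = (b ^ 2 - a ^ 2 / 2) + (if i = j then a ^ 2 / 2 else 0) := by
    intro i j
    by_cases hij : i = j
    · subst hij
      rw [real_inner_self_eq_norm_sq, hvv]; simp
    · have h1 := norm_sub_sq_real (v i) (v j)
      have h2 : v i - v j = P i - P j := by rw [hv, hv]; abel
      rw [h2, hP i j hij, hvv, hvv] at h1
      rw [if_neg hij]; linarith
  have hvd : ∀ i, inner ℝ (v i) d = ‖d‖ ^ 2 / 2 := by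
    intro i
    have h1 := norm_sub_sq_real (v i) d
    have h2 : v i - d = P i - q := by rw [hv, hd]; abel
    rw [h2, hq, hvv] at h1
    linarith
  have hcomb : ∀ (g : Fin n → ℝ) j, inner ℝ (v j) (∑ i, g i • v i)
      = (b ^ 2 - a ^ 2 / 2) * (∑ i, g i) + a ^ 2 / 2 * g j := by
    intro g j
    rw [inner_sum]
    simp only [inner_smul_right, hin, mul_add, Finset.sum_add_distrib, mul_ite, mul_zero,
      Finset.sum_ite_eq, Finset.mem_univ, if_true]
    rw [← Finset.sum_mul]; ring
  have hκ : (b ^ 2 - a ^ 2 / 2) * n + a ^ 2 / 2 = n * c ^ 2 / 4 := by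
    rw [habc]; field_simp; ring
  have hli : LinearIndependent ℝ v := by
    rw [Fintype.linearIndependent_iff]
    intro g hg
    have h1 : ∀ j, (b ^ 2 - a ^ 2 / 2) * (∑ i, g i) + a ^ 2 / 2 * g j = 0 := by
      intro j; rw [← hcomb, hg, inner_zero_right]
    have h2 : ∑ j, ((b ^ 2 - a ^ 2 / 2) * (∑ i, g i) + a ^ 2 / 2 * g j) = 0 :=
      Finset.sum_eq_zero fun j _ => h1 j
    rw [Finset.sum_add_distrib, ← Finset.mul_sum] at h2
    simp only [Finset.sum_const, Finset.card_univ, Fintype.card_fin, nsmul_eq_mul] at h2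
    rw [← Finset.mul_sum] at h2
    have h3 : (n * c ^ 2 / 4) * (∑ i, g i) = 0 := by rw [← hκ]; linear_combination h2
    have h4 : ∑ i, g i = 0 := by
      rcases mul_eq_zero.mp h3 with h | h
      · exfalso; have : 0 < n * c ^ 2 / 4 := by positivity
        linarith
      · exact h
    intro j
    have h5 := h1 j
    rw [h4] at h5
    have : a ^ 2 / 2 * g j = 0 := by linarith
    rcases mul_eq_zero.mp this with h | h
    · exfalso; have : 0 < a ^ 2 / 2 := by positivity
      linarith
    · exact h
  have hspan := hli.span_eq_top_of_card_eq_finrank' (by simp)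
  have hdm : d ∈ Submodule.span ℝ (Set.range v) := by rw [hspan]; trivial
  obtain ⟨g, hg⟩ := (Submodule.mem_span_range_iff_exists_fun ℝ).mp hdm
  have h1 : ∀ j, (b ^ 2 - a ^ 2 / 2) * (∑ i, g i) + a ^ 2 / 2 * g j = ‖d‖ ^ 2 / 2 := by
    intro j; rw [← hcomb, hg, hvd]
  have h2 : (∑ i, g i) * (‖d‖ ^ 2 / 2) = ‖d‖ ^ 2 := by
    rw [Finset.sum_mul, ← real_inner_self_eq_norm_sq]
    nth_rewrite 3 [← hg]
    rw [sum_inner]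
    refine Finset.sum_congr rfl fun i _ => ?_
    rw [real_inner_smul_left, hvd, real_inner_self_eq_norm_sq]
  have h3 : ∑ i, g i = 2 := by
    have : ((∑ i, g i) - 2) * ‖d‖ ^ 2 = 0 := by linarith
    rcases mul_eq_zero.mp this with h | h
    · linarith
    · linarith
  have h4 : ∑ j, ((b ^ 2 - a ^ 2 / 2) * (∑ i, g i) + a ^ 2 / 2 * g j) = ∑ j : Fin n, ‖d‖ ^ 2 / 2 :=
    Finset.sum_congr rfl fun j _ => h1 j
  rw [Finset.sum_add_distrib, ← Finset.mul_sum, h3] at h4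
  simp only [Finset.sum_const, Finset.card_univ, Fintype.card_fin, nsmul_eq_mul] at h4
  rw [← Finset.mul_sum, h3] at h4
  have h5 : (n : ℝ) * ‖d‖ ^ 2 = n * c ^ 2 := by linear_combination (-2) * h4 + 4 * hκ
  have h6 : ‖d‖ ^ 2 = c ^ 2 := mul_left_cancel₀ hn0.ne' h5
  have h7 : ‖d‖ = c := by
    rw [← abs_of_pos hc, ← abs_of_nonneg (norm_nonneg d)]
    exact (sq_eq_sq_iff_abs_eq_abs _ _).mp h6
  rw [norm_sub_rev, ← hd, h7]

/-- Existence of a regular simplex equidistant from two given points. -/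
lemma bq_exists (n : ℕ) (hn : 2 ≤ n) (a b c : ℝ) (ha : 0 < a) (hb : 0 < b) (hc : 0 < c)
    (habc : c ^ 2 = 4 * b ^ 2 - (2 - 2 / (n : ℝ)) * a ^ 2)
    (p q : EuclideanSpace ℝ (Fin n)) (hpq : ‖p - q‖ = c) :
    ∃ P : Fin n → EuclideanSpace ℝ (Fin n), (∀ i j, i ≠ j → ‖P i - P j‖ = a) ∧
      (∀ i, ‖P i - p‖ = b) ∧ (∀ i, ‖P i - q‖ = b) := by
  have hn0 : (0 : ℝ) < n := by positivity
  let o : EuclideanSpace ℝ (Fin n) := WithLp.toLp 2 (fun _ => 1)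
  let e : Fin n → EuclideanSpace ℝ (Fin n) := fun i => EuclideanSpace.single i 1
  have hoo : ‖o‖ ^ 2 = n := by
    rw [EuclideanSpace.norm_sq_eq]; simp [o]
  have heo : ∀ i, inner ℝ (e i) o = 1 := by
    intro i; simp [e, o, EuclideanSpace.inner_single_left]
  have hee : ∀ i, ‖e i‖ ^ 2 = 1 := by intro i; simp [e]
  have hij : ∀ i j, i ≠ j → inner ℝ (e i) (e j) = 0 := by
    intro i j h; simp [e, EuclideanSpace.inner_single_left, h]
  obtain ⟨t, ht⟩ : ∃ t, t = c / (2 * √n) := ⟨_, rfl⟩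
  have ht2 : t ^ 2 * n = c ^ 2 / 4 := by
    rw [ht, div_pow, mul_pow, Real.sq_sqrt hn0.le]; field_simp; norm_num
  have hno : ‖(t • o)‖ = ‖(1 / 2 : ℝ) • (p - q)‖ := by
    rw [norm_smul, norm_smul, hpq]
    rw [← sq_eq_sq₀ (by positivity) (by positivity), mul_pow, hoo, mul_pow, Real.norm_eq_abs,
      sq_abs, ht2]; norm_num; ring
  let R := (ℝ ∙ (t • o - (1 / 2 : ℝ) • (p - q)))ᗮ.reflection
  have hR : R (t • o) = (1 / 2 : ℝ) • (p - q) := Submodule.reflection_sub hno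
  obtain ⟨α, hα⟩ : ∃ α, α = a / √2 := ⟨_, rfl⟩
  have hα2 : α ^ 2 = a ^ 2 / 2 := by rw [hα, div_pow, Real.sq_sqrt (by norm_num)]
  have hkey : ∀ i, ∀ s : ℝ, s ^ 2 * n = c ^ 2 / 4 →
      ‖α • (e i - (1 / n : ℝ) • o) + s • o‖ = b := by
    intro i s hs
    rw [← sq_eq_sq₀ (by positivity) (by positivity), norm_add_sq_real]
    simp only [norm_smul, mul_pow, norm_sub_sq_real, real_inner_smul_left, real_inner_smul_right,
      inner_sub_left, heo, hee, hoo, real_inner_self_eq_norm_sq, Real.norm_eq_abs, sq_abs, hα2]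
    rw [hs, habc]
    field_simp; ring
  refine ⟨fun i => (1 / 2 : ℝ) • (p + q) + R (α • (e i - (1 / n : ℝ) • o)), ?_, ?_, ?_⟩
  · intro i j h
    have : ((1 / 2 : ℝ) • (p + q) + R (α • (e i - (1 / n : ℝ) • o))) -
       ((1 / 2 : ℝ) • (p + q) + R (α • (e j - (1 / n : ℝ) • o))) = R (α • (e i - e j)) := by
      rw [add_sub_add_left_eq_sub, ← map_sub]; congr 1; module
    rw [this, LinearIsometryEquiv.norm_map, ← sq_eq_sq₀ (by positivity) (by positivity),
      norm_smul, mul_pow, norm_sub_sq_real, hee, hee, hij i j h, Real.norm_eq_abs, sq_abs, hα2]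
    ring
  · intro i
    have : ((1 / 2 : ℝ) • (p + q) + R (α • (e i - (1 / n : ℝ) • o))) - p
       = R (α • (e i - (1 / n : ℝ) • o) + (-t) • o) := by
      rw [map_add, neg_smul, map_neg, hR]; module
    simp only [this, LinearIsometryEquiv.norm_map]
    exact hkey i (-t) (by rw [neg_sq, ht2])
  · intro i
    have : ((1 / 2 : ℝ) • (p + q) + R (α • (e i - (1 / n : ℝ) • o))) - q
       = R (α • (e i - (1 / n : ℝ) • o) + t • o) := by
      rw [map_add, hR]; module
    simp only [this, LinearIsometryEquiv.norm_map]
    exact hkey i t ht2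

lemma bq_weak (n : ℕ) (hn : 2 ≤ n) (f : EuclideanSpace ℝ (Fin n) → EuclideanSpace ℝ (Fin n))
    (a b c : ℝ) (ha : 0 < a) (hb : 0 < b) (hc : 0 < c)
    (habc : c ^ 2 = 4 * b ^ 2 - (2 - 2 / (n : ℝ)) * a ^ 2)
    (hfa : BQPres f a) (hfb : BQPres f b) (x y : EuclideanSpace ℝ (Fin n)) (hxy : ‖x - y‖ = c) :
    f x = f y ∨ ‖f x - f y‖ = c := by
  obtain ⟨P, h1, h2, h3⟩ := bq_exists n hn a b c ha hb hc habc x y hxy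
  exact bq_uniq n hn a b c ha hc habc (fun i => f (P i)) (f x) (f y)
    (fun i j h => hfa _ _ (h1 i j h)) (fun i => hfb _ _ (h2 i)) (fun i => hfb _ _ (h3 i))

/-- Triangles exist. -/
lemma bq_tri (n : ℕ) (hn : 2 ≤ n) (x y : EuclideanSpace ℝ (Fin n)) (d r s : ℝ) (hd : 0 < d)
    (hr : 0 < r) (hs : 0 < s) (hxy : ‖x - y‖ = d)
    (h : (d ^ 2 + r ^ 2 - s ^ 2) ^ 2 ≤ 4 * d ^ 2 * r ^ 2) :
    ∃ z, ‖x - z‖ = r ∧ ‖y - z‖ = s := by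
  obtain ⟨w, hw, hw1⟩ : ∃ w : EuclideanSpace ℝ (Fin n), inner ℝ (y - x) w = 0 ∧ ‖w‖ = 1 := by
    have hne : (ℝ ∙ (y - x))ᗮ ≠ ⊥ := by
      intro hbot
      have h1 := Submodule.finrank_add_finrank_orthogonal (ℝ ∙ (y - x))
      rw [hbot, finrank_bot, finrank_euclideanSpace_fin] at h1
      have h2 := finrank_span_le_card (R := ℝ) ({y - x} : Set (EuclideanSpace ℝ (Fin n)))
      simp only [Set.toFinset_singleton, Finset.card_singleton] at h2
      omega
    obtain ⟨w, hw, hw0⟩ := Submodule.exists_mem_ne_zero_of_ne_bot hne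
    rw [Submodule.mem_orthogonal_singleton_iff_inner_right] at hw
    refine ⟨(‖w‖)⁻¹ • w, by rw [inner_smul_right, hw, mul_zero], ?_⟩
    rw [norm_smul, norm_inv, norm_norm, inv_mul_cancel₀ (norm_ne_zero_iff.mpr hw0)]
  obtain ⟨α, hα⟩ : ∃ α, α = (d ^ 2 + r ^ 2 - s ^ 2) / (2 * d ^ 2) := ⟨_, rfl⟩
  have hα1 : 2 * α * d ^ 2 = d ^ 2 + r ^ 2 - s ^ 2 := by rw [hα]; field_simp
  have hnn : 0 ≤ r ^ 2 - α ^ 2 * d ^ 2 := by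
    have : (2 * α * d ^ 2) ^ 2 ≤ 4 * d ^ 2 * r ^ 2 := by rw [hα1]; exact h
    have h2 : 0 ≤ (4 * d ^ 2) * (r ^ 2 - α ^ 2 * d ^ 2) := by nlinarith
    exact nonneg_of_mul_nonneg_right h2 (by positivity)
  obtain ⟨β, hβ⟩ : ∃ β, β = √(r ^ 2 - α ^ 2 * d ^ 2) := ⟨_, rfl⟩
  have hβ2 : β ^ 2 = r ^ 2 - α ^ 2 * d ^ 2 := by rw [hβ, Real.sq_sqrt hnn]
  have hyx : ‖y - x‖ = d := by rw [norm_sub_rev, hxy]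
  have hg : ∀ γ : ℝ, ‖γ • (y - x) + β • w‖ ^ 2 = γ ^ 2 * d ^ 2 + β ^ 2 := by
    intro γ
    rw [norm_add_sq_real, real_inner_smul_left, real_inner_smul_right, hw, norm_smul, norm_smul,
      mul_pow, mul_pow, hyx, hw1, Real.norm_eq_abs, Real.norm_eq_abs, sq_abs, sq_abs]
    ring
  refine ⟨x + (α • (y - x) + β • w), ?_, ?_⟩
  · rw [norm_sub_rev, add_sub_cancel_left, ← sq_eq_sq₀ (by positivity) (by positivity), hg, hβ2]
    ring
  · have : x + (α • (y - x) + β • w) - y = (α - 1) • (y - x) + β • w := by module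
    rw [norm_sub_rev, this, ← sq_eq_sq₀ (by positivity) (by positivity), hg, hβ2]
    linarith

/-- A point on a segment. -/
lemma bq_seg {n : ℕ} (x y : EuclideanSpace ℝ (Fin n)) (c : ℝ) (hxy : 0 < ‖x - y‖) :
    ∃ z, ‖x - z‖ = |c| ∧ ‖z - y‖ = |‖x - y‖ - c| := by
  refine ⟨x + (c / ‖x - y‖) • (y - x), ?_, ?_⟩
  · rw [norm_sub_rev, add_sub_cancel_left, norm_smul, norm_sub_rev y x, norm_div, norm_norm,
      div_mul_cancel₀ _ hxy.ne', Real.norm_eq_abs]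
  · have : x + (c / ‖x - y‖) • (y - x) - y = (1 - c / ‖x - y‖) • (x - y) := by module
    rw [this, norm_smul, Real.norm_eq_abs]
    nth_rewrite 2 [← abs_of_pos hxy]
    rw [← abs_mul, sub_mul, one_mul, div_mul_cancel₀ _ hxy.ne']

lemma bq_lip (n : ℕ) (hn : 2 ≤ n) (f : EuclideanSpace ℝ (Fin n) → EuclideanSpace ℝ (Fin n))
    (c : ℝ) (hc : 0 < c) (h : ∀ x y, ‖x - y‖ = c → ‖f x - f y‖ ≤ c) (k : ℕ) :
    ∀ x y, ‖x - y‖ ≤ (k + 2) * c → ‖f x - f y‖ ≤ (k + 2) * c := by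
  induction k with
  | zero =>
    intro x y hxy
    rcases (norm_nonneg (x - y)).eq_or_lt with h0 | h0
    · have : x = y := sub_eq_zero.mp (norm_eq_zero.mp h0.symm)
      subst this; simp; positivity
    · obtain ⟨z, h1, h2⟩ := bq_tri n hn x y _ c c h0 hc hc rfl (by
        simp only [Nat.cast_zero, zero_add] at hxy
        have : ‖x - y‖ ^ 2 ≤ (2 * c) ^ 2 := by gcongr
        nlinarith [sq_nonneg ‖x - y‖])
      have h3 := h _ _ h1
      have h4 := h _ _ h2
      have h5 := norm_sub_le_norm_sub_add_norm_sub (f x) (f z) (f y)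
      rw [norm_sub_rev (f z) (f y)] at h5
      push_cast; linarith
  | succ k ih =>
    intro x y hxy
    push_cast at hxy ⊢
    by_cases hle : ‖x - y‖ ≤ (k + 2) * c
    · have := ih x y hle
      linarith
    · push Not at hle
      have hck : c ≤ (k + 2) * c := by nlinarith [(Nat.cast_nonneg k : (0 : ℝ) ≤ k)]
      obtain ⟨z, h1, h2⟩ := bq_seg x y c (by linarith)
      rw [abs_of_pos hc] at h1
      rw [abs_of_pos (by linarith)] at h2
      have h3 := h _ _ h1
      have h4 := ih z y (by rw [h2]; linarith)
      have h5 := norm_sub_le_norm_sub_add_norm_sub (f x) (f z) (f y)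
      linarith

/-- If distance `c` maps to `0` or `c` and large distances are preserved, `c` is preserved. -/
lemma bq_upgrade (n : ℕ) (hn : 2 ≤ n) (f : EuclideanSpace ℝ (Fin n) → EuclideanSpace ℝ (Fin n))
    (c : ℝ) (hc : 0 < c) (h : ∀ x y, ‖x - y‖ = c → f x = f y ∨ ‖f x - f y‖ = c)
    (hub : ∀ B : ℝ, ∃ s, B < s ∧ BQPres f s) : BQPres f c := by
  intro x y hxy
  rcases h x y hxy with h0 | h0
  swap
  · exact h0
  exfalso
  obtain ⟨s, hs, hfs⟩ := hub (3 * c)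
  -- `k + 2 < s / c ≤ k + 3`
  obtain ⟨k, hk1, hk2⟩ : ∃ k : ℕ, (k + 2) * c < s ∧ s ≤ (k + 3) * c := by
    have h1 : 3 < s / c := by rw [lt_div_iff₀ hc]; exact hs
    have h2 : 3 < ⌈s / c⌉₊ := by rw [Nat.lt_ceil]; exact_mod_cast h1
    refine ⟨⌈s / c⌉₊ - 3, ?_, ?_⟩
    · have h3 := Nat.ceil_lt_add_one (show 0 ≤ s / c by linarith)
      rw [← lt_div_iff₀ hc, Nat.cast_sub h2.le]; push_cast; linarith
    · have h3 := Nat.le_ceil (s / c)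
      rw [← div_le_iff₀ hc, Nat.cast_sub h2.le]; push_cast; linarith
  obtain ⟨z, h1, h2⟩ := bq_seg x y s (by rw [hxy]; exact hc)
  rw [abs_of_pos (by linarith)] at h1
  rw [hxy, abs_sub_comm, abs_of_pos (by linarith)] at h2
  have h3 := hfs _ _ h1
  have h4 := bq_lip n hn f c hc (fun u v huv => by
    rcases h u v huv with h | h
    · rw [h, sub_self, norm_zero]; exact hc.le
    · exact h.le) k z y (by rw [h2]; linarith)
  rw [h0, norm_sub_rev] at h3
  linarith

lemma bq_grow (n : ℕ) (hn : 2 ≤ n) (f : EuclideanSpace ℝ (Fin n) → EuclideanSpace ℝ (Fin n))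
    (r : ℝ) (hr : 0 < r) (h : BQPres f r) : BQPres f (√(2 + 2 / (n : ℝ)) * r) := by
  have hn0 : (0 : ℝ) < n := by positivity
  have hl : 0 < √(2 + 2 / (n : ℝ)) := by positivity
  have hl2 : √(2 + 2 / (n : ℝ)) ^ 2 = 2 + 2 / (n : ℝ) := Real.sq_sqrt (by positivity)
  have hl3 : 2 < √(2 + 2 / (n : ℝ)) ^ 2 := by
    rw [hl2]; have : 0 < 2 / (n : ℝ) := by positivity
    linarith
  intro x y hxy
  rcases bq_weak n hn f r r (√(2 + 2 / (n : ℝ)) * r) hr hr (by positivity)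
    (by rw [mul_pow, hl2]; ring) h h x y hxy with h0 | h0
  swap
  · exact h0
  exfalso
  generalize √(2 + 2 / (n : ℝ)) = l at *
  obtain ⟨z, h1, h2⟩ := bq_tri n hn x y (l * r) r (l * r) (by positivity) hr (by positivity) hxy
    (by nlinarith [pow_pos hr 4])
  rcases bq_weak n hn f r r (l * r) hr hr (by positivity)
    (by rw [mul_pow, hl2]; ring) h h y z h2 with h3 | h3
  · have h4 := h _ _ h1
    rw [h0, h3, sub_self, norm_zero] at h4
    linarith
  · have h4 := h _ _ h1
    rw [h0, h3] at h4
    have : l = 1 := by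
      have : (l - 1) * r = 0 := by linarith
      rcases mul_eq_zero.mp this with h | h <;> linarith
    rw [this] at hl3; norm_num at hl3

lemma bq_iter {n : ℕ} (f : EuclideanSpace ℝ (Fin n) → EuclideanSpace ℝ (Fin n))
    (l δ : ℝ) (hl : 0 < l) (hδ : 0 < δ) (h : BQPres f δ)
    (hs : ∀ r, 0 < r → BQPres f r → BQPres f (l * r)) (k : ℕ) : BQPres f (l ^ k * δ) := by
  induction k with
  | zero => simpa using h
  | succ k ih =>
    rw [pow_succ', mul_assoc]
    exact hs _ (by positivity) ih

/-- The planar case: reflections in points. -/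
lemma bq_half (n : ℕ) (hn : 2 ≤ n) (f : EuclideanSpace ℝ (Fin n) → EuclideanSpace ℝ (Fin n))
    (r : ℝ) (hr : 0 < r) (h : BQPres f r) (h3 : BQPres f (√3 * r)) : BQPres f (1 / 2 * r) := by
  have hs3 : √3 ^ 2 = 3 := Real.sq_sqrt (by norm_num)
  have key : ∀ x v m u : EuclideanSpace ℝ (Fin n), ‖x + v - m - u‖ ^ 2 =
      ‖x - m‖ ^ 2 + ‖m - v‖ ^ 2 + ‖v - u‖ ^ 2 + ‖u - x‖ ^ 2 - ‖x - v‖ ^ 2 - ‖m - u‖ ^ 2 := by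
    intro x v m u
    simp only [← real_inner_self_eq_norm_sq, inner_sub_left, inner_sub_right, inner_add_left,
      inner_add_right]
    rw [real_inner_comm x v, real_inner_comm x m, real_inner_comm x u, real_inner_comm v m,
      real_inner_comm v u, real_inner_comm m u]
    ring
  have rh : ∀ x m u : EuclideanSpace ℝ (Fin n), ‖x - m‖ = r → ‖x - u‖ = r → ‖m - u‖ = r →
      f (m + u - x) = f m + f u - f x := by
    intro x m u h1 h2 h4
    have h5 : ‖m - (m + u - x)‖ = r := by
      rw [← h2]; congr 1; abel
    have h6 : ‖(m + u - x) - u‖ = r := by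
      rw [← h1, norm_sub_rev x m]; congr 1; abel
    have h7 : ‖x - (m + u - x)‖ = √3 * r := by
      have h8 := key x (m + u - x) m u
      rw [show x + (m + u - x) - m - u = 0 by abel, h1, h5, h6, norm_sub_rev u x, h2, h4,
        norm_zero] at h8
      rw [← sq_eq_sq₀ (by positivity) (by positivity), mul_pow, hs3]; linarith
    have h9 := key (f x) (f (m + u - x)) (f m) (f u)
    rw [h _ _ h1, h _ _ h5, h _ _ h6, norm_sub_rev (f u), h _ _ h2, h3 _ _ h7, h _ _ h4, mul_pow,
      hs3] at h9
    have h10 : ‖f x + f (m + u - x) - f m - f u‖ ^ 2 = 0 := by rw [h9]; ring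
    have h11 := norm_eq_zero.mp (pow_eq_zero_iff (two_ne_zero) |>.mp h10)
    rw [← sub_eq_zero, ← h11]; abel
  have refl : ∀ x m : EuclideanSpace ℝ (Fin n), ‖x - m‖ = r → f (m + m - x) = f m + f m - f x := by
    intro x m hxm
    obtain ⟨u, h1, h2⟩ := bq_tri n hn x m r r r hr hr hr hxm (by nlinarith [pow_pos hr 4])
    have h4 := rh x m u hxm h1 h2
    have h5 := rh u m (m + u - x) (by rw [norm_sub_rev, h2])
      (by rw [← hxm, ← norm_sub_rev m x, norm_sub_rev]; congr 1; abel)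
      (by rw [← h1]; congr 1; abel)
    rw [show m + (m + u - x) - u = m + m - x by abel, h4] at h5
    rw [h5]; abel
  intro x y hxy
  obtain ⟨o, h1, h2⟩ := bq_tri n hn x y (1 / 2 * r) r r (by positivity) hr hr hxy
    (by nlinarith [pow_pos hr 4])
  have h4 := refl o x (by rw [norm_sub_rev, h1])
  have h5 := refl o y (by rw [norm_sub_rev, h2])
  have h6 : ‖(x + x - o) - (y + y - o)‖ = r := by
    rw [show (x + x - o) - (y + y - o) = (2 : ℝ) • (x - y) by module, norm_smul, hxy, Real.norm_eq_abs, abs_of_pos (by norm_num)]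
    ring
  have h7 := h _ _ h6
  rw [h4, h5, show (f x + f x - f o) - (f y + f y - f o) = (2 : ℝ) • (f x - f y) by module,
    norm_smul, Real.norm_eq_abs, abs_of_pos (by norm_num)] at h7
  linarith

lemma bq_isom (n : ℕ) (hn : 2 ≤ n) (δ : ℝ) (hδ : 0 < δ)
    (f : EuclideanSpace ℝ (Fin n) → EuclideanSpace ℝ (Fin n)) (hf : BQPres f δ)
    (x y : EuclideanSpace ℝ (Fin n)) : ‖f x - f y‖ = ‖x - y‖ := by
  have hn0 : (0 : ℝ) < n := by positivity
  have hl : 1 < √(2 + 2 / (n : ℝ)) := by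
    rw [Real.lt_sqrt (by norm_num)]; have : 0 < 2 / (n : ℝ) := by positivity
    linarith
  have hub : ∀ B : ℝ, ∃ s, B < s ∧ BQPres f s := by
    intro B
    obtain ⟨k, hk⟩ := pow_unbounded_of_one_lt (B / δ) hl
    exact ⟨_, (div_lt_iff₀ hδ).mp hk,
      bq_iter f _ δ (by linarith) hδ hf (fun r hr h => bq_grow n hn f r hr h) k⟩
  obtain ⟨ρ, hρ0, hρ1, hρ⟩ : ∃ ρ : ℝ, 0 < ρ ∧ ρ < 1 ∧
      ∀ r, 0 < r → BQPres f r → BQPres f (ρ * r) := by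
    rcases hn.eq_or_lt with h2 | h2
    · refine ⟨1 / 2, by norm_num, by norm_num, fun r hr h => bq_half n hn f r hr h ?_⟩
      have := bq_grow n hn f r hr h
      have h3 : (2 : ℝ) + 2 / (n : ℝ) = 3 := by rw [← h2]; norm_num
      rwa [h3] at this
    · have h3 : (3 : ℝ) ≤ n := by exact_mod_cast h2
      refine ⟨2 / n, by positivity, by rw [div_lt_one hn0]; linarith, fun r hr h => ?_⟩
      refine bq_upgrade n hn f _ (by positivity) ?_ hub
      refine bq_weak n hn f (√(2 + 2 / (n : ℝ)) * r) r _ (by positivity) hr (by positivity) ?_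
        (bq_grow n hn f r hr h) h
      rw [mul_pow, mul_pow, Real.sq_sqrt (by positivity)]
      field_simp; ring
  have hnon : ∀ x y, ‖f x - f y‖ ≤ ‖x - y‖ := by
    intro x y
    refine le_of_forall_pos_le_add fun ε hε => ?_
    obtain ⟨k, hk⟩ := exists_pow_lt_of_lt_one (show 0 < ε / (2 * δ) by positivity) hρ1
    have hc := bq_iter f ρ δ hρ0 hδ hf hρ k
    obtain ⟨c, hcdef⟩ : ∃ c, c = ρ ^ k * δ := ⟨_, rfl⟩
    rw [← hcdef] at hc
    have hc0 : 0 < c := by rw [hcdef]; positivity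
    have hcε : 2 * c < ε := by
      rw [lt_div_iff₀ (by positivity)] at hk; rw [hcdef]; linarith
    have h1 := Nat.le_ceil (‖x - y‖ / c)
    have h1' := Nat.floor_le (show 0 ≤ ‖x - y‖ / c by positivity)
    have h2 := (Nat.lt_floor_add_one (‖x - y‖ / c)).le
    rw [div_le_iff₀ hc0] at h2
    rw [le_div_iff₀ hc0] at h1'
    have := bq_lip n hn f c hc0 (fun u v h => (hc u v h).le) _ x y
      (h2.trans (by nlinarith))
    linarith
  apply le_antisymm (hnon x y)
  rcases (norm_nonneg (x - y)).eq_or_lt with h0 | h0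
  · rw [← h0]; exact norm_nonneg _
  obtain ⟨s, hs, hfs⟩ := hub ‖x - y‖
  obtain ⟨z, h1, h2⟩ := bq_seg x y s h0
  rw [abs_of_pos (by linarith)] at h1
  rw [abs_sub_comm, abs_of_pos (by linarith)] at h2
  have h3 := hfs _ _ h1
  have h4 := hnon z y
  have h5 := norm_sub_le_norm_sub_add_norm_sub (f x) (f y) (f z)
  rw [norm_sub_rev (f y) (f z)] at h5
  linarith

/-- **Beckman–Quarles.** For `n ≥ 2`, any map `f : ℝⁿ → ℝⁿ` that preserves
a single Euclidean distance `δ > 0` is a Euclidean motion `x ↦ A·x + a` with `A`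
orthogonal; in particular it preserves all distances. -/
theorem beckman_quarles (n : ℕ) (hn : 2 ≤ n) (δ : ℝ) (hδ : 0 < δ)
    (f : EuclideanSpace ℝ (Fin n) → EuclideanSpace ℝ (Fin n))
    (hf : ∀ x y, ‖x - y‖ = δ → ‖f x - f y‖ = δ) :
    ∃ (A : EuclideanSpace ℝ (Fin n) →ₗ[ℝ] EuclideanSpace ℝ (Fin n))
      (a : EuclideanSpace ℝ (Fin n)),
      (∀ x, ‖A x‖ = ‖x‖) ∧ (∀ x, f x = A x + a) ∧
      ∀ x y, ‖f x - f y‖ = ‖x - y‖ := by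
  have hiso := bq_isom n hn δ hδ f hf
  have hI : Isometry f := Isometry.of_dist_eq fun x y => by
    rw [dist_eq_norm, dist_eq_norm, hiso]
  let g := hI.affineIsometryOfStrictConvexSpace
  have hg : ∀ x, g x = f x := fun x => rfl
  refine ⟨g.linearIsometry.toLinearMap, f 0, fun x => g.linearIsometry.norm_map x, fun x => ?_, hiso⟩
  have := g.map_vadd 0 x
  simp only [vadd_eq_add, add_zero, hg] at this
  exact this
end

section
/- Let n ≥ 2, let U ⊆ ℝⁿ be an open connected and simply connected set, and let f : U → ℝⁿ be three times continuously differentiable with invertible differential at every point of U, such that f maps every straight segment contained in U into a straight line (i.e. for every affine line ℓ, the image f(ℓ ∩ U) is contained in some affine line of ℝⁿ). Then f is the restriction of a projective map: there exist a linear map A : ℝⁿ → ℝⁿ, vectors a, p ∈ ℝⁿ, and q ∈ ℝ such that ⟨p, x⟩ + q ≠ 0 for all x ∈ U and f(x) = (A·x + a)/(⟨p, x⟩ + q) for all x ∈ U. -/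
section Helpers
open Topology Filter
/-- algebra: symmetric bilinear maps preserving directions. -/
lemma alg_form {n : ℕ} (B : (Fin n → ℝ) →L[ℝ] (Fin n → ℝ) →L[ℝ] (Fin n → ℝ))
    (hs : ∀ u v, B u v = B v u) (hB : ∀ v, ∃ c : ℝ, B v v = c • v)
    (ω : (Fin n → ℝ) →L[ℝ] ℝ)
    (hω : ∀ i, ω (Pi.single i 1) = (1/2) * B (Pi.single i 1) (Pi.single i 1) i)
    (u v : Fin n → ℝ) : B u v = ω u • v + ω v • u := by
  have key : ∀ i j, B (Pi.single i 1) (Pi.single j 1) =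
      ω (Pi.single i 1) • Pi.single j 1 + ω (Pi.single j 1) • (Pi.single i 1 : Fin n → ℝ) := by
    have hd : ∀ i, B (Pi.single i 1) (Pi.single i 1) =
        (2 * ω (Pi.single i 1)) • (Pi.single i 1 : Fin n → ℝ) := by
      intro i
      obtain ⟨c, hc⟩ := hB (Pi.single i 1)
      have := hω i
      rw [hc] at this
      simp at this
      rw [hc, this]; congr 1; ring
    intro i j
    by_cases hij : i = j
    · subst hij; rw [hd i, two_mul, add_smul]
    obtain ⟨c, hc⟩ := hB (Pi.single i 1 + Pi.single j 1)
    obtain ⟨d, hd'⟩ := hB (Pi.single i 1 - Pi.single j 1)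
    simp only [map_add, map_sub, ContinuousLinearMap.add_apply, ContinuousLinearMap.sub_apply,
      hd, hs (Pi.single j 1) (Pi.single i 1)] at hc hd'
    generalize ω (Pi.single i 1) = p at *
    generalize ω (Pi.single j 1) = q at *
    generalize B (Pi.single i 1) (Pi.single j 1) = z at *
    have hji : j ≠ i := fun h => hij h.symm
    have c1 := congrFun hc i
    have c2 := congrFun hc j
    have d1 := congrFun hd' i
    have d2 := congrFun hd' j
    simp [hij, hji] at c1 c2 d1 d2
    ext k
    have c3 := congrFun hc k
    by_cases hki : k = i
    · subst hki; simp [hij, hji]; linarith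
    by_cases hkj : k = j
    · subst hkj; simp [hij, hji]; linarith
    simp [hki, hkj] at c3 ⊢
    linarith
  let C : (Fin n → ℝ) →ₗ[ℝ] (Fin n → ℝ) →ₗ[ℝ] (Fin n → ℝ) :=
    LinearMap.mk₂ ℝ (fun u v => B u v - (ω u • v + ω v • u))
      (by intros; simp; module) (by intros; simp; module)
      (by intros; simp; module) (by intros; simp; module)
  have hC : C = 0 := by
    refine (Pi.basisFun ℝ (Fin n)).ext fun i => (Pi.basisFun ℝ (Fin n)).ext fun j => ?_
    simp [C, key]
  have := LinearMap.congr_fun (LinearMap.congr_fun hC u) v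
  simp only [C, LinearMap.mk₂_apply, LinearMap.zero_apply] at this
  exact sub_eq_zero.mp this

lemma alg_h {E : Type*} [AddCommGroup E] [Module ℝ E] (hE : ∀ u : E, u ≠ 0 → ∃ w, LinearIndependent ℝ ![u, w])
    (h : E → E → ℝ) (h0' : ∀ u, h 0 u = 0)
    (hh : ∀ w u v, (h w u - h u w) • v + h w v • u - h u v • w = 0)
    (u v : E) : h u v = 0 := by
  have two : ∀ u w, LinearIndependent ℝ ![u, w] → h u u = 0 ∧ h u w = 0 := by
    intro u w hl
    rw [LinearIndependent.pair_iff] at hl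
    have a1 := hl (2 * h w u - h u w) (- h u u) (by rw [← hh w u u]; module)
    have a2 := hl (- h w w) (2 * h u w - h w u) (by rw [← hh u w w]; module)
    constructor <;> linarith
  by_cases hu : u = 0
  · rw [hu, h0']
  by_cases hl : LinearIndependent ℝ ![u, v]
  · exact (two u v hl).2
  · obtain ⟨w, hw⟩ := hE u hu
    have hw' := hw
    rw [LinearIndependent.pair_iff] at hw
    rw [LinearIndependent.pair_iff] at hl
    push Not at hl
    obtain ⟨s, t, hst, hne⟩ := hl
    have ht : t ≠ 0 := by
      rintro rfl
      simp [hu] at hst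
      exact hne hst rfl
    have hv : v = (-(s / t)) • u := by
      have : t • v = -(s • u) := eq_neg_of_add_eq_zero_right hst
      rw [← inv_smul_smul₀ ht v, this]; module
    -- use hh u w v : (h u w - h w u) • v + h u v • w - h w v • u = 0
    have := hh u w v
    rw [hv] at this
    have := hw ((h u w - h w u) * (-(s / t)) - h w v) (h u v) (by rw [← this, ← hv, hv]; module)
    exact this.2

lemma dir_form {n : ℕ} (U : Set (Fin n → ℝ)) (hU : IsOpen U) (f : (Fin n → ℝ) → (Fin n → ℝ))
    (hC : ∀ x ∈ U, ContDiffAt ℝ 3 f x)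
    (hinj : ∀ x ∈ U, ∀ v, fderiv ℝ f x v = 0 → v = 0)
    (hline : ∀ a b : Fin n → ℝ, a ≠ 0 → ∃ a' b' : Fin n → ℝ, a' ≠ 0 ∧
      ∀ s : ℝ, b + s • a ∈ U → ∃ s' : ℝ, f (b + s • a) = b' + s' • a')
    (x : Fin n → ℝ) (hx : x ∈ U) (v : Fin n → ℝ) :
    ∃ c : ℝ, fderiv ℝ (fderiv ℝ f) x v v = c • fderiv ℝ f x v := by
  by_cases hv : v = 0
  · exact ⟨0, by simp [hv]⟩
  obtain ⟨a', b', ha', h⟩ := hline v x hv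
  obtain ⟨i, hi⟩ : ∃ i, a' i ≠ 0 := by
    by_contra hcon
    push Not at hcon
    exact ha' (funext hcon)
  let M : (Fin n → ℝ) →L[ℝ] (Fin n → ℝ) := ContinuousLinearMap.id ℝ _ -
    (a' i)⁻¹ • (ContinuousLinearMap.proj (R := ℝ) (φ := fun _ : Fin n => ℝ) i).smulRight a'
  have hM : ∀ z, M z = z - ((a' i)⁻¹ * z i) • a' := by
    intro z; simp [M, smul_smul]
  have hMa : M a' = 0 := by rw [hM, inv_mul_cancel₀ hi]; simp
  have hl : ∀ s : ℝ, HasDerivAt (fun s : ℝ => x + s • v) v s := by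
    intro s
    simpa using ((hasDerivAt_id s).smul_const v).const_add x
  have hev : ∀ s : ℝ, x + s • v ∈ U → ∀ᶠ t in 𝓝 s, x + t • v ∈ U := fun s hs =>
    (hl s).continuousAt.eventually_mem (hU.mem_nhds hs)
  have h1 : ∀ s : ℝ, x + s • v ∈ U → M (fderiv ℝ f (x + s • v) v) = 0 := by
    intro s hs
    have hf : HasFDerivAt f (fderiv ℝ f (x + s • v)) (x + s • v) :=
      ((hC _ hs).differentiableAt (by norm_num)).hasFDerivAt
    have d1 : HasDerivAt (fun t : ℝ => M (f (x + t • v))) (M (fderiv ℝ f (x + s • v) v)) s :=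
      M.hasFDerivAt.comp_hasDerivAt s (hf.comp_hasDerivAt s (hl s))
    have d2 : HasDerivAt (fun t : ℝ => M (f (x + t • v))) 0 s := by
      refine (hasDerivAt_const s (M b')).congr_of_eventuallyEq ?_
      filter_upwards [hev s hs] with t ht
      obtain ⟨s', hs'⟩ := h t ht
      simp [hs', hMa]
    exact d1.unique d2
  have hx0 : x + (0 : ℝ) • v ∈ U := by simpa using hx
  have h2 : M (fderiv ℝ (fderiv ℝ f) x v v) = 0 := by
    have hP : HasFDerivAt (fderiv ℝ f) (fderiv ℝ (fderiv ℝ f) (x + (0:ℝ) • v)) (x + (0:ℝ) • v) :=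
      (((hC _ hx0).fderiv_right (m := 2) (by norm_num)).differentiableAt (by norm_num)).hasFDerivAt
    have d1 : HasDerivAt (fun t : ℝ => M (fderiv ℝ f (x + t • v) v))
        (M (fderiv ℝ (fderiv ℝ f) (x + (0:ℝ) • v) v v)) 0 := by
      have e := (hP.comp_hasDerivAt (0:ℝ) (hl 0))
      have e2 := e.clm_apply (hasDerivAt_const (0:ℝ) v)
      have e3 := M.hasFDerivAt.comp_hasDerivAt (0:ℝ) e2
      simp only [map_zero, add_zero] at e3
      exact e3
    have d2 : HasDerivAt (fun t : ℝ => M (fderiv ℝ f (x + t • v) v)) 0 0 := by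
      refine (hasDerivAt_const (0:ℝ) (0 : Fin n → ℝ)).congr_of_eventuallyEq ?_
      filter_upwards [hev 0 hx0] with t ht
      exact h1 t ht
    simpa using d1.unique d2
  have h3 := h1 0 hx0
  rw [zero_smul, add_zero] at h3
  rw [hM, sub_eq_zero] at h2 h3
  set c := (a' i)⁻¹ * (fderiv ℝ f x) v i
  set d := (a' i)⁻¹ * ((fderiv ℝ (fderiv ℝ f) x) v) v i
  have hc : c ≠ 0 := by
    intro hc
    rw [hc, zero_smul] at h3
    exact hv (hinj x hx v h3)
  refine ⟨d / c, ?_⟩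
  rw [h2, h3, smul_smul, div_mul_cancel₀ _ hc]

/-- existence of the differentiable one-form. -/
lemma exists_form {n : ℕ} (U : Set (Fin n → ℝ)) (f : (Fin n → ℝ) → (Fin n → ℝ))
    (hC : ∀ x ∈ U, ContDiffAt ℝ 3 f x)
    (hD : ∀ x ∈ U, ∃ D : (Fin n → ℝ) ≃L[ℝ] (Fin n → ℝ),
      fderiv ℝ f x = (D : (Fin n → ℝ) →L[ℝ] (Fin n → ℝ)))
    (hdir : ∀ x ∈ U, ∀ v, ∃ c : ℝ, fderiv ℝ (fderiv ℝ f) x v v = c • fderiv ℝ f x v) :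
    ∃ ω : (Fin n → ℝ) → ((Fin n → ℝ) →L[ℝ] ℝ), (∀ x ∈ U, DifferentiableAt ℝ ω x) ∧
      ∀ x ∈ U, ∀ u v, fderiv ℝ (fderiv ℝ f) x u v =
        ω x u • fderiv ℝ f x v + ω x v • fderiv ℝ f x u := by
  refine ⟨fun x => ∑ i, ((1/2 : ℝ) * ((fderiv ℝ f x).inverse
    (fderiv ℝ (fderiv ℝ f) x (Pi.single i 1) (Pi.single i 1))) i) •
      (ContinuousLinearMap.proj (R := ℝ) (φ := fun _ : Fin n => ℝ) i), ?_, ?_⟩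
  · intro x hx
    have hP : ContDiffAt ℝ 2 (fderiv ℝ f) x := (hC _ hx).fderiv_right (m := 2) (by norm_num)
    have hQ : DifferentiableAt ℝ (fderiv ℝ (fderiv ℝ f)) x :=
      (hP.fderiv_right (m := 1) (by norm_num)).differentiableAt (by norm_num)
    have hI : DifferentiableAt ℝ (fun x => (fderiv ℝ f x).inverse) x := by
      obtain ⟨D, hD⟩ := hD x hx
      have : DifferentiableAt ℝ ContinuousLinearMap.inverse (fderiv ℝ f x) := by
        rw [hD]
        exact (contDiffAt_map_inverse (n := 1) D).differentiableAt (by norm_num)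
      exact this.comp x (hP.differentiableAt (by norm_num))
    refine DifferentiableAt.fun_sum fun i _ => ?_
    refine DifferentiableAt.smul_const ?_ _
    refine DifferentiableAt.const_mul ?_ _
    have : DifferentiableAt ℝ (fun x => (fderiv ℝ f x).inverse
      (fderiv ℝ (fderiv ℝ f) x (Pi.single i 1) (Pi.single i 1))) x := by
      fun_prop
    exact differentiableAt_pi.1 this i
  · intro x hx u v
    obtain ⟨D, hD⟩ := hD x hx
    have hsym : IsSymmSndFDerivAt ℝ f x := (hC x hx).isSymmSndFDerivAt (by simp; norm_num)
    let B : (Fin n → ℝ) →L[ℝ] (Fin n → ℝ) →L[ℝ] (Fin n → ℝ) :=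
      (ContinuousLinearMap.compL ℝ (Fin n → ℝ) (Fin n → ℝ) (Fin n → ℝ)
        (D.symm : (Fin n → ℝ) →L[ℝ] (Fin n → ℝ))).comp (fderiv ℝ (fderiv ℝ f) x)
    have hBe : ∀ u v, B u v = D.symm (fderiv ℝ (fderiv ℝ f) x u v) := fun u v => rfl
    have := alg_form B (fun u v => by rw [hBe, hBe, hsym u v]) (fun v => by
      obtain ⟨c, hc⟩ := hdir x hx v
      refine ⟨c, ?_⟩
      rw [hBe, hc, hD]; simp) (∑ i, ((1/2 : ℝ) * ((fderiv ℝ f x).inverse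
    (fderiv ℝ (fderiv ℝ f) x (Pi.single i 1) (Pi.single i 1))) i) •
      (ContinuousLinearMap.proj (R := ℝ) (φ := fun _ : Fin n => ℝ) i)) (by
        intro i
        rw [hBe, hD, ContinuousLinearMap.inverse_equiv]
        simp [ContinuousLinearMap.sum_apply, Pi.single_apply]) u v
    rw [hBe] at this
    have := congrArg D this
    rw [D.apply_symm_apply, map_add, map_smul, map_smul] at this
    rw [this]
    simp only [hD]
    rfl

lemma form_deriv {n : ℕ} (hn : 2 ≤ n) (U : Set (Fin n → ℝ)) (hU : IsOpen U)
    (f : (Fin n → ℝ) → (Fin n → ℝ))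
    (hC : ∀ x ∈ U, ContDiffAt ℝ 3 f x)
    (hinj : ∀ x ∈ U, ∀ v, fderiv ℝ f x v = 0 → v = 0)
    (ω : (Fin n → ℝ) → ((Fin n → ℝ) →L[ℝ] ℝ)) (hω : ∀ x ∈ U, DifferentiableAt ℝ ω x)
    (hQ : ∀ x ∈ U, ∀ u v, fderiv ℝ (fderiv ℝ f) x u v =
        ω x u • fderiv ℝ f x v + ω x v • fderiv ℝ f x u)
    (x : Fin n → ℝ) (hx : x ∈ U) (u v : Fin n → ℝ) :
    fderiv ℝ ω x u v = ω x u * ω x v := by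
  have hE : ∀ u : (Fin n → ℝ), u ≠ 0 → ∃ w, LinearIndependent ℝ ![u, w] := by
    intro u hu
    have : 1 < Module.finrank ℝ (Fin n → ℝ) := by simp; omega
    obtain ⟨w, hw⟩ := exists_linearIndependent_pair_of_one_lt_finrank this hu
    exact ⟨w, hw⟩
  have hP : ContDiffAt ℝ 2 (fderiv ℝ f) x := (hC _ hx).fderiv_right (m := 2) (by norm_num)
  have hPd := (hP.differentiableAt (by norm_num)).hasFDerivAt
  have hQd : HasFDerivAt (fderiv ℝ (fderiv ℝ f)) (fderiv ℝ (fderiv ℝ (fderiv ℝ f)) x) x :=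
      ((hP.fderiv_right (m := 1) (by norm_num)).differentiableAt (by norm_num)).hasFDerivAt
  have hsym : IsSymmSndFDerivAt ℝ (fderiv ℝ f) x := hP.isSymmSndFDerivAt (by simp)
  have hsymf : IsSymmSndFDerivAt ℝ f x := (hC x hx).isSymmSndFDerivAt (by simp; norm_num)
  have hR : ∀ w u v, fderiv ℝ (fderiv ℝ (fderiv ℝ f)) x w u v =
      (fderiv ℝ ω x w u) • fderiv ℝ f x v + ω x u • fderiv ℝ (fderiv ℝ f) x w v +
      ((fderiv ℝ ω x w v) • fderiv ℝ f x u + ω x v • fderiv ℝ (fderiv ℝ f) x w u) := by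
    intro w u v
    have e1 := (hQd.clm_apply (hasFDerivAt_const u x)).clm_apply (hasFDerivAt_const v x)
    have eω := (hω x hx).hasFDerivAt
    have e2 := ((eω.clm_apply (hasFDerivAt_const u x)).smul
        (hPd.clm_apply (hasFDerivAt_const v x))).add
      ((eω.clm_apply (hasFDerivAt_const v x)).smul (hPd.clm_apply (hasFDerivAt_const u x)))
    have e3 := e2.congr_of_eventuallyEq (f₁ := fun y => fderiv ℝ (fderiv ℝ f) y u v) (by
      filter_upwards [hU.mem_nhds hx] with y hy
      exact hQ y hy u v)
    have := DFunLike.congr_fun (e1.unique e3) w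
    simp at this
    rw [this]; abel
  have := alg_h hE (fun u v => fderiv ℝ ω x u v - ω x u * ω x v) (by intro u; simp) (by
    intro w u v
    apply hinj x hx
    have h1 := hR w u v
    rw [hsym w u, hR u w v, hQ x hx, hQ x hx, hQ x hx, hQ x hx] at h1
    rw [map_sub, map_add, map_smul, map_smul, map_smul]
    rw [← sub_eq_zero] at h1
    rw [← neg_eq_zero, ← h1]
    module) u v
  exact sub_eq_zero.mp this

lemma local_form {n : ℕ} (U : Set (Fin n → ℝ)) (hU : IsOpen U)
    (f : (Fin n → ℝ) → (Fin n → ℝ))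
    (hC : ∀ x ∈ U, ContDiffAt ℝ 3 f x)
    (ω : (Fin n → ℝ) → ((Fin n → ℝ) →L[ℝ] ℝ)) (hω : ∀ x ∈ U, DifferentiableAt ℝ ω x)
    (hQ : ∀ x ∈ U, ∀ u v, fderiv ℝ (fderiv ℝ f) x u v =
        ω x u • fderiv ℝ f x v + ω x v • fderiv ℝ f x u)
    (hω' : ∀ x ∈ U, ∀ u v, fderiv ℝ ω x u v = ω x u * ω x v)
    (x₀ : Fin n → ℝ) (hx : x₀ ∈ U) :
    ∃ r > 0, ∃ (p : (Fin n → ℝ) →L[ℝ] ℝ) (q : ℝ) (L : (Fin n → ℝ) →L[ℝ] (Fin n → ℝ))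
      (c : Fin n → ℝ), p x₀ + q ≠ 0 ∧ Metric.ball x₀ r ⊆ U ∧
        ∀ x ∈ Metric.ball x₀ r, (p x + q) • f x = L x + c := by
  obtain ⟨r, hr, hball⟩ := Metric.isOpen_iff.1 hU x₀ hx
  let φ : (Fin n → ℝ) → ℝ := fun x => (-ω x₀) x + (1 + ω x₀ x₀)
  have hφd : ∀ x, HasFDerivAt φ (-ω x₀) x := fun x => (-ω x₀).hasFDerivAt.add_const _
  have hφ0 : φ x₀ = 1 := by simp [φ]
  have hconv : Convex ℝ (Metric.ball x₀ r) := convex_ball _ _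
  have hx0 : x₀ ∈ Metric.ball x₀ r := Metric.mem_ball_self hr
  -- the ODE argument
  have hσ : ∀ x ∈ Metric.ball x₀ r, φ x • ω x = ω x₀ := by
    intro x hxb
    let γ : ℝ → (Fin n → ℝ) := fun t => x₀ + t • (x - x₀)
    have hγ : ∀ t ∈ Set.Icc (0:ℝ) 1, γ t ∈ U := fun t ht =>
      hball (hconv.add_smul_sub_mem hx0 hxb ht)
    have hγd : ∀ s : ℝ, HasDerivAt γ (x - x₀) s := by
      intro s
      have e := ((hasDerivAt_id s).smul_const (x - x₀)).const_add x₀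
      rw [one_smul] at e
      exact e
    have hωd : ∀ t ∈ Set.Icc (0:ℝ) 1, HasDerivAt (fun t => ω (γ t))
        (fderiv ℝ ω (γ t) (x - x₀)) t := fun t ht =>
      (hω _ (hγ t ht)).hasFDerivAt.comp_hasDerivAt t (hγd t)
    have hφγ : ∀ t, HasDerivAt (fun t => φ (γ t)) (-(ω x₀ (x - x₀))) t := fun t =>
      (hφd (γ t)).comp_hasDerivAt t (hγd t)
    have hσd : ∀ t ∈ Set.Icc (0:ℝ) 1, HasDerivAt (fun t => φ (γ t) • ω (γ t) - ω x₀)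
        (((φ (γ t) • ω (γ t) - ω x₀) (x - x₀)) • ω (γ t)) t := by
      intro t ht
      have e := ((hφγ t).smul (hωd t ht)).sub_const (ω x₀)
      refine e.congr_deriv ?_
      refine ContinuousLinearMap.ext fun w => ?_
      have h1 := hω' _ (hγ t ht) (x - x₀) w
      simp only [add_apply, sub_apply, smul_apply, smul_eq_mul, h1]
      ring
    have hωc : ContinuousOn (fun t => ω (γ t)) (Set.Icc 0 1) := fun t ht =>
      (hωd t ht).continuousAt.continuousWithinAt
    obtain ⟨K, hK⟩ := isCompact_Icc.exists_bound_of_continuousOn hωc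
    have := eq_zero_of_abs_deriv_le_mul_abs_self_of_eq_zero_right
      (f := fun t => φ (γ t) • ω (γ t) - ω x₀) (K := ‖x - x₀‖ * K) (a := 0) (b := 1)
      (fun t ht => (hσd t ht).continuousAt.continuousWithinAt)
      (fun t ht => (hσd t ⟨ht.1, ht.2.le⟩).hasDerivWithinAt)
      (by simp [γ, hφ0]) (by
        intro t ht
        rw [norm_smul]
        have h1 := (φ (γ t) • ω (γ t) - ω x₀).le_opNorm (x - x₀)
        have h2 := hK t ⟨ht.1, ht.2.le⟩
        calc _ ≤ (‖φ (γ t) • ω (γ t) - ω x₀‖ * ‖x - x₀‖) * K := by gcongr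
          _ = _ := by ring) 1 ⟨zero_le_one, le_rfl⟩
    have := sub_eq_zero.1 this
    simpa [γ] using this
  have hfd : ∀ x ∈ U, HasFDerivAt f (fderiv ℝ f x) x := fun x hx =>
    ((hC x hx).differentiableAt (by norm_num)).hasFDerivAt
  have hPd : ∀ x ∈ U, HasFDerivAt (fderiv ℝ f) (fderiv ℝ (fderiv ℝ f) x) x := fun x hx =>
    (((hC _ hx).fderiv_right (m := 2) (by norm_num)).differentiableAt (by norm_num)).hasFDerivAt
  have hF : ∀ x ∈ U, HasFDerivAt (fun x => φ x • f x)
      (φ x • fderiv ℝ f x + (-ω x₀).smulRight (f x)) x := fun x hx => (hφd x).smul (hfd x hx)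
  let G : (Fin n → ℝ) → (Fin n → ℝ) →L[ℝ] (Fin n → ℝ) :=
    fun x => φ x • fderiv ℝ f x + (-ω x₀).smulRight (f x)
  have hGv : ∀ v : Fin n → ℝ, ∀ x ∈ Metric.ball x₀ r, HasFDerivAt (𝕜 := ℝ) (fun x => G x v) 0 x := by
    intro v x hxb
    have hxU := hball hxb
    have e1 := ((hφd x).smul ((hPd x hxU).clm_apply (hasFDerivAt_const v x))).add
      ((hfd x hxU).const_smul ((-ω x₀) v))
    refine HasFDerivAt.congr_fderiv (f := fun x => G x v) e1 ?_
    refine ContinuousLinearMap.ext fun w => ?_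
    have hs := fun w => DFunLike.congr_fun (hσ x hxb) w
    simp only [ContinuousLinearMap.smul_apply, smul_eq_mul] at hs
    simp [hQ x hxU, ← hs]
    module
  have hG : ∀ x ∈ Metric.ball x₀ r, G x = G x₀ := by
    intro x hxb
    ext1 v
    exact Metric.isOpen_ball.is_const_of_fderiv_eq_zero hconv.isPreconnected
      (f := fun x => G x v) (𝕜 := ℝ)
      (fun y hy => (hGv v y hy).differentiableAt.differentiableWithinAt)
      (fun y hy => (hGv v y hy).fderiv) hxb hx0
  obtain ⟨c, hc⟩ := Metric.isOpen_ball.exists_eq_add_of_fderiv_eq (𝕜 := ℝ) hconv.isPreconnected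
    (f := fun x => φ x • f x) (g := fun x => G x₀ x)
    (fun y hy => (hF y (hball hy)).differentiableAt.differentiableWithinAt)
    (G x₀).differentiable.differentiableOn (fun y hy => by
      rw [(hF y (hball hy)).fderiv]
      exact (hG y hy).trans (G x₀).fderiv.symm)
  refine ⟨r, hr, -ω x₀, 1 + ω x₀ x₀, G x₀, c, ?_, hball, fun x hx => hc hx⟩
  simp

lemma global_form {n : ℕ} (U : Set (Fin n → ℝ)) (hU : IsOpen U) (hconn : IsConnected U)
    (f : (Fin n → ℝ) → (Fin n → ℝ))
    (hfd : ∀ x ∈ U, HasFDerivAt f (fderiv ℝ f x) x)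
    (hinj : ∀ x ∈ U, ∀ v, fderiv ℝ f x v = 0 → v = 0)
    (hloc : ∀ x₀ ∈ U, ∃ r > 0, ∃ (p : (Fin n → ℝ) →L[ℝ] ℝ) (q : ℝ)
      (L : (Fin n → ℝ) →L[ℝ] (Fin n → ℝ))
      (c : Fin n → ℝ), p x₀ + q ≠ 0 ∧ Metric.ball x₀ r ⊆ U ∧
        ∀ x ∈ Metric.ball x₀ r, (p x + q) • f x = L x + c) :
    ∃ (p : (Fin n → ℝ) →L[ℝ] ℝ) (q : ℝ) (L : (Fin n → ℝ) →L[ℝ] (Fin n → ℝ))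
      (c : Fin n → ℝ), ∀ x ∈ U, p x + q ≠ 0 ∧ (p x + q) • f x = L x + c := by
  obtain ⟨x₀, hx₀⟩ := hconn.nonempty
  obtain ⟨r, hr, p, q, L, c, hne, hb, heq⟩ := hloc x₀ hx₀
  have hsub : U ⊆ {x | ∀ᶠ y in 𝓝 x, (p y + q) • f y = L y + c} := by
    refine hconn.isPreconnected.subset_of_closure_inter_subset isOpen_setOf_eventually_nhds
      ⟨x₀, hx₀, ?_⟩ ?_
    · filter_upwards [Metric.ball_mem_nhds x₀ hr] with y hy using heq y hy
    · rintro x ⟨hxc, hxU⟩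
      obtain ⟨r', hr', p', q', L', c', hne', hb', heq'⟩ := hloc x hxU
      obtain ⟨z, hz, hzb⟩ := mem_closure_iff_nhds.1 hxc _ (Metric.ball_mem_nhds x hr')
      have hz' : ∀ᶠ y in 𝓝 z, (p y + q) • (L' y + c') = (p' y + q') • (L y + c) := by
        filter_upwards [hzb, Metric.isOpen_ball.mem_nhds hz] with y h1 h2
        rw [← heq' y h2, ← h1, smul_comm]
      have hall : (fun y => (p y + q) • (L' y + c')) = (fun y => (p' y + q') • (L y + c)) := by
        refine AnalyticOnNhd.eq_of_eventuallyEq (𝕜 := ℝ) (z₀ := z) ?_ ?_ hz'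
        · exact fun y _ => ((p.analyticAt y).add analyticAt_const).smul
            ((L'.analyticAt y).add analyticAt_const)
        · exact fun y _ => ((p'.analyticAt y).add analyticAt_const).smul
            ((L.analyticAt y).add analyticAt_const)
      have hc : ContinuousAt (fun y => p' y + q') x := by fun_prop
      filter_upwards [Metric.ball_mem_nhds x hr', hc.eventually_ne hne'] with y h1 h2
      have h3 := congrFun hall y
      rw [← heq' y h1, smul_comm] at h3
      exact smul_right_injective _ h2 h3
  refine ⟨p, q, L, c, fun x hx => ⟨fun h0 => ?_, (hsub hx).self_of_nhds⟩⟩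
  have hxe := hsub hx
  have hx1 : L x + c = 0 := by
    have := hxe.self_of_nhds
    rw [h0, zero_smul] at this
    exact this.symm
  -- derivative of both sides at x
  have hL : ∀ v, L v = p v • f x := by
    intro v
    have e1 := (p.hasFDerivAt (x := x)).add_const q |>.smul (hfd x hx)
    have e2 := (L.hasFDerivAt (x := x)).add_const c
    have e3 := e2.congr_of_eventuallyEq hxe
    have := DFunLike.congr_fun (e1.unique e3) v
    simp [h0] at this
    exact this.symm
  obtain ⟨v, hv⟩ : ∃ v, p v ≠ 0 := by
    by_contra hcon
    push Not at hcon
    rw [hcon] at h0 hne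
    exact hne h0
  have hl : HasDerivAt (fun s : ℝ => x + s • v) v 0 := by
    have e := ((hasDerivAt_id (0:ℝ)).smul_const v).const_add x
    rw [one_smul] at e
    exact e
  have hl0 : x = x + (0:ℝ) • v := by simp
  have hd1 : HasDerivAt (fun s : ℝ => f (x + s • v)) (fderiv ℝ f x v) 0 :=
    HasFDerivAt.comp_hasDerivAt_of_eq (0:ℝ) (hfd x hx) hl hl0
  have hd2 : HasDerivAt (fun s : ℝ => f (x + s • v)) 0 0 := by
    refine (hasDerivAt_const (0:ℝ) (f x)).congr_of_eventuallyEq ?_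
    have ht : Tendsto (fun s : ℝ => x + s • v) (𝓝 0) (𝓝 x) := by
      have := hl.continuousAt.tendsto
      simpa using this
    filter_upwards [ht.eventually hxe] with s hs
    by_cases hs0 : s = 0
    · simp [hs0]
    have hp : p (x + s • v) + q = s * p v := by
      rw [map_add, map_smul, smul_eq_mul]; linarith
    have hLs : L (x + s • v) + c = (s * p v) • f x := by
      rw [map_add, map_smul, hL v, add_right_comm, hx1, zero_add, smul_smul]
    rw [hp, hLs] at hs
    exact smul_right_injective _ (mul_ne_zero hs0 hv) hs
  have := hinj x hx v (hd1.unique hd2)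
  exact hv (by simp [this])

end Helpers


/-- For `n ≥ 2`, let `U ⊆ ℝⁿ` be open, connected and simply connected,
and let `f : U → ℝⁿ` be `C³` with invertible differential everywhere on `U`, mapping every
straight segment contained in `U` into a straight line. Then `f` is the restriction of a
projective map: `f x = (A·x + a)/(⟨p, x⟩ + q)` on `U`. -/
theorem local_collineations_projective (n : ℕ) (hn : 2 ≤ n)
    (U : Set (Fin n → ℝ)) (hopen : IsOpen U) (hconn : IsConnected U)
    (hsc : SimplyConnectedSpace U)
    (f : (Fin n → ℝ) → (Fin n → ℝ))
    (hC3 : ContDiffOn ℝ 3 f U)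
    (hdiff : ∀ x ∈ U, ∃ D : (Fin n → ℝ) ≃L[ℝ] (Fin n → ℝ),
      HasFDerivWithinAt f (D : (Fin n → ℝ) →L[ℝ] (Fin n → ℝ)) U x)
    (hline : ∀ a b : Fin n → ℝ, a ≠ 0 → ∃ a' b' : Fin n → ℝ, a' ≠ 0 ∧
      ∀ s : ℝ, b + s • a ∈ U → ∃ s' : ℝ, f (b + s • a) = b' + s' • a') :
    ∃ (A : (Fin n → ℝ) →ₗ[ℝ] (Fin n → ℝ)) (a pvec : Fin n → ℝ) (q : ℝ),
      (∀ x ∈ U, (∑ i, pvec i * x i) + q ≠ 0) ∧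
      ∀ x ∈ U, f x = ((∑ i, pvec i * x i) + q)⁻¹ • (A x + a) := by
  have hC : ∀ x ∈ U, ContDiffAt ℝ 3 f x := fun x hx => hC3.contDiffAt (hopen.mem_nhds hx)
  have hD : ∀ x ∈ U, ∃ D : (Fin n → ℝ) ≃L[ℝ] (Fin n → ℝ),
      fderiv ℝ f x = (D : (Fin n → ℝ) →L[ℝ] (Fin n → ℝ)) := fun x hx => by
    obtain ⟨D, h⟩ := hdiff x hx
    exact ⟨D, (h.hasFDerivAt (hopen.mem_nhds hx)).fderiv⟩
  have hinj : ∀ x ∈ U, ∀ v, fderiv ℝ f x v = 0 → v = 0 := by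
    intro x hx v hv
    obtain ⟨D, h⟩ := hD x hx
    rw [h] at hv
    exact D.map_eq_zero_iff.1 hv
  obtain ⟨ω, hω, hQ⟩ := exists_form U f hC hD (dir_form U hopen f hC hinj hline)
  have hω' := form_deriv hn U hopen f hC hinj ω hω hQ
  obtain ⟨p, q, L, c, h⟩ := global_form U hopen hconn f
    (fun x hx => ((hC x hx).differentiableAt (by norm_num)).hasFDerivAt) hinj
    (local_form U hopen f hC ω hω hQ hω')
  have hp : ∀ x, ∑ i, p (Pi.single i 1) * x i = p x := by
    intro x
    conv_rhs => rw [pi_eq_sum_univ' x]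
    rw [map_sum]
    refine Finset.sum_congr rfl fun i _ => ?_
    rw [map_smul, smul_eq_mul, mul_comm]
  refine ⟨L, c, fun i => p (Pi.single i 1), q, ?_, ?_⟩
  · intro x hx
    rw [hp]
    exact (h x hx).1
  · intro x hx
    rw [hp, ContinuousLinearMap.coe_coe, ← (h x hx).2, inv_smul_smul₀ (h x hx).1]
end
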